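/- arXiv:2405.16305 — 4 statements merged into one kernel-verified Lean document; each statement's English description precedes it below -/
import Mathlib

section
/- Let n ≥ 1 and let v ∈ ℝⁿ be nonzero. An n×n real matrix L satisfies Lᵀ = −L and L v = 0 if and only if there exists a skew-symmetric matrix A ∈ Matrix n n ℝ such that L = P⊥_v A P⊥_v. -/
open Matrix

/-- The action of a real matrix on a Euclidean vector. -/
noncomputable def mulVecE {m n : ℕ} (A : Matrix (Fin m) (Fin n) ℝ)
    (v : EuclideanSpace ℝ (Fin n)) : EuclideanSpace ℝ (Fin m) :=
  Matrix.toEuclideanLin A v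

/-- The orthogonal projector `P⊥_v = I - v vᵀ / ‖v‖²` onto the orthogonal complement
of the span of `v`. -/
noncomputable def projPerp {n : ℕ} (v : EuclideanSpace ℝ (Fin n)) :
    Matrix (Fin n) (Fin n) ℝ :=
  1 - (‖v‖ ^ 2)⁻¹ • Matrix.vecMulVec (fun i => v i) (fun i => v i)

theorem mulVecE_eq_zero_iff {m n : ℕ} (A : Matrix (Fin m) (Fin n) ℝ)
    (v : EuclideanSpace ℝ (Fin n)) : mulVecE A v = 0 ↔ A *ᵥ (fun i => v i) = 0 := by
  rw [mulVecE, Matrix.toLpLin_apply, WithLp.toLp_eq_zero]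

theorem transpose_projPerp {n : ℕ} (v : EuclideanSpace ℝ (Fin n)) :
    (projPerp v)ᵀ = projPerp v := by
  rw [projPerp, transpose_sub, transpose_one, transpose_smul, transpose_vecMulVec]

theorem projPerp_mulVec_self {n : ℕ} {v : EuclideanSpace ℝ (Fin n)} (hv : v ≠ 0) :
    projPerp v *ᵥ (fun i => v i) = 0 := by
  have hdot : (fun i => v i) ⬝ᵥ (fun i => v i) = ‖v‖ ^ 2 := by
    simp only [EuclideanSpace.real_norm_sq_eq, dotProduct, ← sq]
  have hnorm : ‖v‖ ^ 2 ≠ 0 := by simpa using hv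
  rw [projPerp, sub_mulVec, one_mulVec, smul_mulVec, vecMulVec_mulVec, hdot]
  ext i
  simp [field]

theorem mul_projPerp_of_mulVec_eq_zero {m n : ℕ} {A : Matrix (Fin m) (Fin n) ℝ}
    {v : EuclideanSpace ℝ (Fin n)} (h : A *ᵥ (fun i => v i) = 0) :
    A * projPerp v = A := by
  rw [projPerp, Matrix.mul_sub, Matrix.mul_one, Matrix.mul_smul, mul_vecMulVec, h]
  simp

/-- For a nonzero vector `v`, a matrix `L` is skew-symmetric with `L v = 0` if and only
if `L = P⊥_v A P⊥_v` for some skew-symmetric matrix `A`. -/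
theorem skew_degenerate_iff_projPerp_conj {n : ℕ} (hn : 1 ≤ n)
    (v : EuclideanSpace ℝ (Fin n)) (hv : v ≠ 0)
    (L : Matrix (Fin n) (Fin n) ℝ) :
    (Lᵀ = -L ∧ mulVecE L v = 0) ↔
      ∃ A : Matrix (Fin n) (Fin n) ℝ, Aᵀ = -A ∧ L = projPerp v * A * projPerp v := by
  rw [mulVecE_eq_zero_iff]
  constructor
  · rintro ⟨hL, hLv⟩
    have hright : L * projPerp v = L := mul_projPerp_of_mulVec_eq_zero hLv
    have hleft : projPerp v * L = L := by
      apply transpose_injective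
      rw [transpose_mul, transpose_projPerp, hL, Matrix.neg_mul, hright]
    exact ⟨L, hL, by rw [hleft, hright]⟩
  · rintro ⟨A, hA, rfl⟩
    constructor
    · simp only [transpose_mul, transpose_projPerp, hA, Matrix.neg_mul, Matrix.mul_neg,
        Matrix.mul_assoc]
    · rw [← mulVec_mulVec, projPerp_mulVec_self hv, mulVec_zero]
end

section
/- Let n ≥ 1 and let v, w ∈ ℝⁿ with v ≠ 0 and ‖v − w‖ ≤ ‖v‖/2. Then w ≠ 0 and the orthogonal projectors satisfy ‖P⊥_v − P⊥_w‖ ≤ 12 ‖v − w‖ / ‖v‖, where ‖·‖ on matrices denotes the operator norm induced by the Euclidean norm. -/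
open Matrix

/-- The operator norm of a real matrix induced by the Euclidean norms. -/
noncomputable def opNorm {m n : ℕ} (A : Matrix (Fin m) (Fin n) ℝ) : ℝ :=
  ‖LinearMap.toContinuousLinearMap (Matrix.toEuclideanLin A)‖

/-- Normalizing vectors is Lipschitz away from the origin. -/
theorem norm_inv_norm_smul_sub_inv_norm_smul_le {E : Type*} [NormedAddCommGroup E]
    [NormedSpace ℝ E] {v w : E} (hv : v ≠ 0) (hw : w ≠ 0) :
    ‖‖v‖⁻¹ • v - ‖w‖⁻¹ • w‖ ≤ 2 * ‖v - w‖ / ‖v‖ := by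
  have hv' : 0 < ‖v‖ := norm_pos_iff.2 hv
  have hw' : 0 < ‖w‖ := norm_pos_iff.2 hw
  have key : ‖v‖⁻¹ • v - ‖w‖⁻¹ • w
      = ‖v‖⁻¹ • ((v - w) + (‖w‖ - ‖v‖) • ‖w‖⁻¹ • w) := by
    match_scalars <;> field_simp
    ring
  have hunit : ‖‖w‖⁻¹ • w‖ = 1 := norm_smul_inv_norm (𝕜 := ℝ) hw
  rw [key, norm_smul, norm_inv, norm_norm, div_eq_inv_mul]
  gcongr
  calc ‖(v - w) + (‖w‖ - ‖v‖) • ‖w‖⁻¹ • w‖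
      ≤ ‖v - w‖ + ‖(‖w‖ - ‖v‖) • ‖w‖⁻¹ • w‖ := norm_add_le _ _
    _ = ‖v - w‖ + |‖w‖ - ‖v‖| := by rw [norm_smul, hunit, mul_one, Real.norm_eq_abs]
    _ ≤ ‖v - w‖ + ‖v - w‖ := by
        gcongr
        rw [norm_sub_rev v w]
        exact abs_norm_sub_norm_le w v
    _ = 2 * ‖v - w‖ := (two_mul _).symm

/-- The rank-one projections onto the lines spanned by two unit vectors are close when the
vectors are. -/
theorem norm_inner_smul_sub_inner_smul_le {E : Type*} [NormedAddCommGroup E]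
    [InnerProductSpace ℝ E] {a b : E} (ha : ‖a‖ = 1) (hb : ‖b‖ = 1) (x : E) :
    ‖inner ℝ b x • b - inner ℝ a x • a‖ ≤ 2 * ‖a - b‖ * ‖x‖ := by
  have key : inner ℝ b x • b - inner ℝ a x • a
      = inner ℝ (b - a) x • b + inner ℝ a x • (b - a) := by
    rw [inner_sub_left]
    module
  have h₁ : ‖inner ℝ (b - a) x‖ ≤ ‖b - a‖ * ‖x‖ := norm_inner_le_norm _ _
  have h₂ : ‖inner ℝ a x‖ ≤ ‖x‖ := by simpa [ha] using norm_inner_le_norm (𝕜 := ℝ) a x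
  calc ‖inner ℝ b x • b - inner ℝ a x • a‖
      ≤ ‖inner ℝ (b - a) x‖ * ‖b‖ + ‖inner ℝ a x‖ * ‖b - a‖ := by
        rw [key, ← norm_smul, ← norm_smul]
        exact norm_add_le _ _
    _ ≤ ‖b - a‖ * ‖x‖ * ‖b‖ + ‖x‖ * ‖b - a‖ := by gcongr
    _ = 2 * ‖a - b‖ * ‖x‖ := by
        rw [hb, norm_sub_rev a b]
        ring

theorem toEuclideanLin_projPerp_apply {n : ℕ} (v x : EuclideanSpace ℝ (Fin n)) :
    Matrix.toEuclideanLin (projPerp v) x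
      = x - inner ℝ (‖v‖⁻¹ • v) x • ‖v‖⁻¹ • v := by
  ext i
  simp [projPerp, Matrix.toLpLin_apply,
    Matrix.vecMulVec_mulVec, inner_smul_left, EuclideanSpace.inner_eq_star_dotProduct,
    dotProduct_comm]
  ring

/-- If `v ≠ 0` and `‖v - w‖ ≤ ‖v‖/2`, then `w ≠ 0` and the orthogonal projectors
satisfy `‖P⊥_v - P⊥_w‖ ≤ 12 ‖v - w‖ / ‖v‖` in the operator norm. -/
theorem projPerp_diff_opNorm_bound {n : ℕ} (hn : 1 ≤ n)
    (v w : EuclideanSpace ℝ (Fin n)) (hv : v ≠ 0)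
    (hvw : ‖v - w‖ ≤ ‖v‖ / 2) :
    w ≠ 0 ∧ opNorm (projPerp v - projPerp w) ≤ 12 * ‖v - w‖ / ‖v‖ := by
  have hv' : 0 < ‖v‖ := norm_pos_iff.2 hv
  have hw : w ≠ 0 := by
    rintro rfl
    rw [sub_zero] at hvw
    linarith
  refine ⟨hw, ContinuousLinearMap.opNorm_le_bound _ (by positivity) fun x => ?_⟩
  rw [LinearMap.coe_toContinuousLinearMap', map_sub, LinearMap.sub_apply,
    toEuclideanLin_projPerp_apply, toEuclideanLin_projPerp_apply, sub_sub_sub_cancel_left]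
  refine (norm_inner_smul_sub_inner_smul_le (norm_smul_inv_norm (𝕜 := ℝ) hv)
    (norm_smul_inv_norm (𝕜 := ℝ) hw) x).trans ?_
  gcongr
  calc 2 * ‖‖v‖⁻¹ • v - ‖w‖⁻¹ • w‖
      ≤ 2 * (2 * ‖v - w‖ / ‖v‖) := by
        gcongr
        exact norm_inv_norm_smul_sub_inv_norm_smul_le hv hw
    _ = 4 * ‖v - w‖ / ‖v‖ := by ring
    _ ≤ 12 * ‖v - w‖ / ‖v‖ := by
        gcongr
        norm_num
end

section
/- Let a ≥ 1/2, b ≥ 0, ε > 0 and T > 0, and let x, x̃ : [0, T] → ℝⁿ be differentiable with x(0) = x̃(0) and ‖x'(t) − x̃'(t)‖ ≤ a ‖x(t) − x̃(t)‖ + ε b for all t ∈ [0, T]. Then ( ∫₀^T ‖x(t) − x̃(t)‖² dt )^{1/2} ≤ ε (b/a) √( e^{2 a T} − 2 e^{a T} + T + 1 ). -/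
open Set

/-- The squared Grönwall profile is dominated by the derivative of
`t ↦ e^{2at} - 2e^{at} + t` for nonnegative times when `a ≥ 1/2`. -/
lemma sq_exp_sub_one_le {a t : ℝ} (ha : 1 / 2 ≤ a) (ht : 0 ≤ t) :
    (Real.exp (a * t) - 1) ^ 2 ≤
      2 * a * Real.exp (2 * a * t) - 2 * (a * Real.exp (a * t)) + 1 := by
  have hsq : Real.exp (2 * a * t) = Real.exp (a * t) ^ 2 := by
    rw [← Real.exp_nat_mul]
    congr 1
    push_cast
    ring
  have hE : 1 ≤ Real.exp (a * t) := Real.one_le_exp (by positivity)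
  have h : 0 ≤ Real.exp (a * t) * ((2 * a - 1) * (Real.exp (a * t) - 1) + 1) := by
    have h1 : 0 ≤ (2 * a - 1) * (Real.exp (a * t) - 1) :=
      mul_nonneg (by linarith) (by linarith)
    positivity
  rw [hsq]
  linarith

/-- If `x` and `x̃` share the initial condition and satisfy the differential inequality
`‖x'(t) - x̃'(t)‖ ≤ a ‖x(t) - x̃(t)‖ + ε b` on `[0, T]` with `a ≥ 1/2`, then the
`L²`-in-time error satisfies
`(∫₀^T ‖x - x̃‖² dt)^{1/2} ≤ ε (b/a) √(e^{2aT} - 2e^{aT} + T + 1)`. -/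
theorem l2_error_bound {n : ℕ} (a b ε T : ℝ)
    (ha : 1 / 2 ≤ a) (hb : 0 ≤ b) (hε : 0 < ε) (hT : 0 < T)
    (x x' z z' : ℝ → EuclideanSpace ℝ (Fin n))
    (hx : ∀ t ∈ Icc (0 : ℝ) T, HasDerivAt x (x' t) t)
    (hz : ∀ t ∈ Icc (0 : ℝ) T, HasDerivAt z (z' t) t)
    (h0 : x 0 = z 0)
    (hbound : ∀ t ∈ Icc (0 : ℝ) T, ‖x' t - z' t‖ ≤ a * ‖x t - z t‖ + ε * b) :
    Real.sqrt (∫ t in (0 : ℝ)..T, ‖x t - z t‖ ^ 2) ≤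
      ε * (b / a) * Real.sqrt (Real.exp (2 * a * T) - 2 * Real.exp (a * T) + T + 1) := by
  have ha0 : 0 < a := by linarith
  have hcont : ContinuousOn (fun t => x t - z t) (Icc 0 T) := fun t ht =>
    ((hx t ht).sub (hz t ht)).continuousAt.continuousWithinAt
  have hpt : ∀ t ∈ Icc (0 : ℝ) T,
      ‖x t - z t‖ ≤ ε * (b / a) * (Real.exp (a * t) - 1) := by
    intro t ht
    have h := norm_le_gronwallBound_of_norm_deriv_right_le (δ := 0) hcont
      (fun s hs => ((hx s (Ico_subset_Icc_self hs)).sub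
        (hz s (Ico_subset_Icc_self hs))).hasDerivWithinAt)
      (by simp [h0]) (fun s hs => hbound s (Ico_subset_Icc_self hs)) t ht
    simpa [gronwallBound_of_K_ne_0 ha0.ne', mul_div_assoc] using h
  have hderiv : ∀ t : ℝ, HasDerivAt
      (fun t => Real.exp (2 * a * t) - 2 * Real.exp (a * t) + t)
      (2 * a * Real.exp (2 * a * t) - 2 * (a * Real.exp (a * t)) + 1) t := by
    intro t
    have hexp : ∀ c : ℝ, HasDerivAt (fun t => Real.exp (c * t)) (c * Real.exp (c * t)) t :=
      fun c => by simpa [mul_comm] using ((hasDerivAt_id t).const_mul c).exp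
    exact ((hexp (2 * a)).sub ((hexp a).const_mul 2)).add (hasDerivAt_id t)
  have hint : ∫ t in (0 : ℝ)..T,
      (2 * a * Real.exp (2 * a * t) - 2 * (a * Real.exp (a * t)) + 1) =
      Real.exp (2 * a * T) - 2 * Real.exp (a * T) + T + 1 := by
    rw [intervalIntegral.integral_eq_sub_of_hasDerivAt (fun t _ => hderiv t)
      (Continuous.intervalIntegrable (by fun_prop) _ _)]
    simp
    ring
  have hle : ∫ t in (0 : ℝ)..T, ‖x t - z t‖ ^ 2 ≤ (ε * (b / a)) ^ 2 *
      (Real.exp (2 * a * T) - 2 * Real.exp (a * T) + T + 1) := by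
    rw [← hint, ← intervalIntegral.integral_const_mul]
    refine intervalIntegral.integral_mono_on hT.le ?_
      (Continuous.intervalIntegrable (by fun_prop) _ _) fun t ht => ?_
    · exact ContinuousOn.intervalIntegrable_of_Icc hT.le (hcont.norm.pow 2)
    · calc ‖x t - z t‖ ^ 2 ≤ (ε * (b / a) * (Real.exp (a * t) - 1)) ^ 2 := by
            gcongr
            exact hpt t ht
        _ = (ε * (b / a)) ^ 2 * (Real.exp (a * t) - 1) ^ 2 := mul_pow _ _ 2
        _ ≤ _ := by
            gcongr
            exact sq_exp_sub_one_le ha ht.1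
  calc Real.sqrt (∫ t in (0 : ℝ)..T, ‖x t - z t‖ ^ 2)
      ≤ Real.sqrt ((ε * (b / a)) ^ 2 *
          (Real.exp (2 * a * T) - 2 * Real.exp (a * T) + T + 1)) := Real.sqrt_le_sqrt hle
    _ = _ := by rw [Real.sqrt_mul (sq_nonneg _), Real.sqrt_sq (by positivity)]
end

section
/- Let n ≥ 1, let K ⊆ ℝⁿ, let T > 0 and ε > 0. Let E, S, Ẽ, S̃ : ℝⁿ → ℝ be differentiable, and let L, M, L̃, M̃ : ℝⁿ → Matrix n n ℝ. Suppose: (i) ∇E and ∇S are Lipschitz on K with constants L_{∇E} and L_{∇S}, and L̃ and M̃ are Lipschitz on K with constants L_{L̃} and L_{M̃} (operator norm on matrices); (ii) the quantities sup_{z∈K}‖L(z)‖, sup_{z∈K}‖M(z)‖, sup_{z∈K}‖L̃(z)‖, sup_{z∈K}‖M̃(z)‖, sup_{z∈K}‖∇E(z)‖, sup_{z∈K}‖∇S(z)‖ are finite; (iii) sup_{z∈K}‖L(z) − L̃(z)‖ ≤ ε, sup_{z∈K}‖M(z) − M̃(z)‖ ≤ ε, sup_{z∈K}‖∇E(z)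 − ∇Ẽ(z)‖ ≤ ε, and sup_{z∈K}‖∇S(z) − ∇S̃(z)‖ ≤ ε. Define a := L_{∇E} sup_K‖L‖ + L_{L̃} sup_K‖∇E‖ + L_{∇S} sup_K‖M‖ + L_{M̃} sup_K‖∇S‖ and b := sup_K‖L̃‖ + sup_K‖∇E‖ + sup_K‖M̃‖ + sup_K‖∇S‖, and assume a ≥ 1/2. If x, x̃ : [0, T] → ℝⁿ are differentiable curves taking values in K with x(0) = x̃(0), x'(t) = L(x(t))∇E(x(t)) + M(x(t))∇S(x(t)) and x̃'(t) = L̃(x̃(t))∇Ẽ(x̃(t)) + M̃(x̃(t))∇S̃(x̃(t)) for all t ∈ [0, T], then ( ∫₀^T ‖x(t) − x̃(t)‖² dt )^{1/2} ≤ ε (b/a) √( e^{2 a T} − 2 e^{a T} + T + 1 ). -/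
open Matrix Set

theorem norm_mulVecE_le {m n : ℕ} (A : Matrix (Fin m) (Fin n) ℝ)
    (v : EuclideanSpace ℝ (Fin n)) : ‖mulVecE A v‖ ≤ opNorm A * ‖v‖ :=
  (LinearMap.toContinuousLinearMap (Matrix.toEuclideanLin A)).le_opNorm v

theorem opNorm_nonneg {m n : ℕ} (A : Matrix (Fin m) (Fin n) ℝ) : 0 ≤ opNorm A :=
  norm_nonneg _

theorem mulVecE_sub_mulVecE {m n : ℕ} (A A₁ A₂ : Matrix (Fin m) (Fin n) ℝ)
    (u v w : EuclideanSpace ℝ (Fin n)) :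
    mulVecE A u - mulVecE A₂ w =
      mulVecE A (u - v) + mulVecE (A - A₁) v + mulVecE (A₁ - A₂) v + mulVecE A₂ (v - w) := by
  simp only [mulVecE, map_sub, LinearMap.sub_apply]
  abel

/-- If the matrix field `A` and the vector field `g` are approximated on `K` by `A'` and `g'`
within `ε`, then the products `A g` at `x` and `A' g'` at `z` differ by at most an affine function
of `‖x - z‖`. -/
theorem norm_mulVecE_sub_mulVecE_le {m n : ℕ} {K : Set (EuclideanSpace ℝ (Fin n))}
    {A A' : EuclideanSpace ℝ (Fin n) → Matrix (Fin m) (Fin n) ℝ}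
    {g g' : EuclideanSpace ℝ (Fin n) → EuclideanSpace ℝ (Fin n)} {ε Lg LA : ℝ}
    (hLipg : ∀ z ∈ K, ∀ w ∈ K, ‖g z - g w‖ ≤ Lg * ‖z - w‖)
    (hLipA : ∀ z ∈ K, ∀ w ∈ K, opNorm (A' z - A' w) ≤ LA * ‖z - w‖)
    (hBddA : BddAbove ((fun z => opNorm (A z)) '' K))
    (hBddA' : BddAbove ((fun z => opNorm (A' z)) '' K))
    (hBddg : BddAbove ((fun z => ‖g z‖) '' K))
    (hεA : ∀ z ∈ K, opNorm (A z - A' z) ≤ ε)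
    (hεg : ∀ z ∈ K, ‖g z - g' z‖ ≤ ε)
    {x z : EuclideanSpace ℝ (Fin n)} (hx : x ∈ K) (hz : z ∈ K) :
    ‖mulVecE (A x) (g x) - mulVecE (A' z) (g' z)‖ ≤
      (Lg * sSup ((fun z => opNorm (A z)) '' K) + LA * sSup ((fun z => ‖g z‖) '' K)) * ‖x - z‖ +
        ε * (sSup ((fun z => opNorm (A' z)) '' K) + sSup ((fun z => ‖g z‖) '' K)) := by
  have hA : opNorm (A x) ≤ sSup ((fun z => opNorm (A z)) '' K) :=
    le_csSup hBddA (mem_image_of_mem _ hx)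
  have hA' : opNorm (A' z) ≤ sSup ((fun z => opNorm (A' z)) '' K) :=
    le_csSup hBddA' (mem_image_of_mem _ hz)
  have hg : ‖g z‖ ≤ sSup ((fun z => ‖g z‖) '' K) :=
    le_csSup hBddg (mem_image_of_mem _ hz)
  have h₁ := (norm_mulVecE_le (A x) (g x - g z)).trans <|
    mul_le_mul hA (hLipg x hx z hz) (norm_nonneg _) ((opNorm_nonneg _).trans hA)
  have h₂ := (norm_mulVecE_le (A x - A' x) (g z)).trans <|
    mul_le_mul (hεA x hx) hg (norm_nonneg _) ((opNorm_nonneg _).trans (hεA x hx))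
  have h₃ := (norm_mulVecE_le (A' x - A' z) (g z)).trans <|
    mul_le_mul (hLipA x hx z hz) hg (norm_nonneg _) ((opNorm_nonneg _).trans (hLipA x hx z hz))
  have h₄ := (norm_mulVecE_le (A' z) (g z - g' z)).trans <|
    mul_le_mul hA' (hεg z hz) (norm_nonneg _) ((opNorm_nonneg _).trans hA')
  rw [mulVecE_sub_mulVecE (A x) (A' x) (A' z) (g x) (g z) (g' z)]
  refine norm_add₄_le.trans ?_
  linarith

theorem integral_sq_exp_sub_one {a : ℝ} (ha : a ≠ 0) (T : ℝ) :
    ∫ t in (0 : ℝ)..T, (Real.exp (a * t) - 1) ^ 2 =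
      (Real.exp (a * T) - 1) * (Real.exp (a * T) - 3) / (2 * a) + T := by
  have hderiv (t : ℝ) : HasDerivAt
      (fun t => (Real.exp (a * t) - 1) * (Real.exp (a * t) - 3) / (2 * a) + t)
      ((Real.exp (a * t) - 1) ^ 2) t := by
    have he : HasDerivAt (fun t => Real.exp (a * t)) (Real.exp (a * t) * a) t := by
      simpa using ((hasDerivAt_id t).const_mul a).exp
    refine ((((he.sub_const 1).mul (he.sub_const 3)).div_const (2 * a)).add
      (hasDerivAt_id t)).congr_deriv ?_
    field_simp
    ring
  rw [intervalIntegral.integral_eq_sub_of_hasDerivAt (fun t _ => hderiv t)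
    (Continuous.intervalIntegrable (by fun_prop) _ _)]
  simp

theorem integral_sq_exp_sub_one_le {a T : ℝ} (ha : 1 / 2 ≤ a) (hT : 0 ≤ T) :
    ∫ t in (0 : ℝ)..T, (Real.exp (a * t) - 1) ^ 2 ≤
      Real.exp (2 * a * T) - 2 * Real.exp (a * T) + T + 1 := by
  have hexp : Real.exp (2 * a * T) = Real.exp (a * T) ^ 2 := by
    rw [← Real.exp_nat_mul]
    ring_nf
  have hone : 1 ≤ Real.exp (a * T) := Real.one_le_exp (by positivity)
  have hle : (Real.exp (a * T) - 1) * (Real.exp (a * T) - 3) / (2 * a) ≤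
      (Real.exp (a * T) - 1) ^ 2 := by
    rw [div_le_iff₀ (by linarith)]
    nlinarith [mul_nonneg (sq_nonneg (Real.exp (a * T) - 1)) (by linarith : 0 ≤ 2 * a - 1)]
  rw [integral_sq_exp_sub_one (by linarith), hexp]
  linarith

/-- An `L²`-in-time form of Grönwall's inequality for a curve starting at the origin. -/
theorem sqrt_integral_norm_sq_le_of_norm_deriv_le {F : Type*} [NormedAddCommGroup F]
    [NormedSpace ℝ F] {y y' : ℝ → F} {a c T : ℝ} (ha : 1 / 2 ≤ a) (hc : 0 ≤ c) (hT : 0 ≤ T)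
    (hy₀ : y 0 = 0) (hy : ∀ t ∈ Icc 0 T, HasDerivAt y (y' t) t)
    (hbound : ∀ t ∈ Icc 0 T, ‖y' t‖ ≤ a * ‖y t‖ + c) :
    Real.sqrt (∫ t in (0 : ℝ)..T, ‖y t‖ ^ 2) ≤
      c / a * Real.sqrt (Real.exp (2 * a * T) - 2 * Real.exp (a * T) + T + 1) := by
  have ha₀ : 0 < a := by linarith
  have hcont : ContinuousOn y (Icc 0 T) := fun t ht => (hy t ht).continuousAt.continuousWithinAt
  have hgronwall (t : ℝ) (ht : t ∈ Icc 0 T) : ‖y t‖ ≤ c / a * (Real.exp (a * t) - 1) := by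
    have h := norm_le_gronwallBound_of_norm_deriv_right_le (δ := 0) hcont
      (fun s hs => (hy s (Ico_subset_Icc_self hs)).hasDerivWithinAt) (by simp [hy₀])
      (fun s hs => hbound s (Ico_subset_Icc_self hs)) t ht
    simpa [gronwallBound_of_K_ne_0 ha₀.ne'] using h
  have hint : ∫ t in (0 : ℝ)..T, ‖y t‖ ^ 2 ≤
      (c / a) ^ 2 * (Real.exp (2 * a * T) - 2 * Real.exp (a * T) + T + 1) := calc
    _ ≤ ∫ t in (0 : ℝ)..T, (c / a) ^ 2 * (Real.exp (a * t) - 1) ^ 2 := by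
      refine intervalIntegral.integral_mono_on hT ?_
        (Continuous.intervalIntegrable (by fun_prop) _ _) fun t ht => ?_
      · exact ContinuousOn.intervalIntegrable_of_Icc hT (hcont.norm.pow 2)
      · rw [← mul_pow]
        exact pow_le_pow_left₀ (norm_nonneg _) (hgronwall t ht) 2
    _ ≤ _ := by
      rw [intervalIntegral.integral_const_mul]
      exact mul_le_mul_of_nonneg_left (integral_sq_exp_sub_one_le ha hT) (sq_nonneg _)
  refine (Real.sqrt_le_sqrt hint).trans_eq ?_
  rw [Real.sqrt_mul (sq_nonneg _), Real.sqrt_sq (by positivity)]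

/-- Generalization-error bound for learned metriplectic systems: if the surrogate data
`(L', M', E', S')` approximates the true metriplectic data `(L, M, E, S)` uniformly to
within `ε` on `K`, the true gradients and surrogate matrix fields are Lipschitz on `K`,
all relevant suprema over `K` are finite, and `a`, `b` aggregate the Lipschitz constants
and uniform bounds respectively (with `a ≥ 1/2`), then trajectories of the two systems
with shared initial condition that remain in `K` on `[0, T]` satisfy the `L²`-in-time
error bound `(∫₀^T ‖x - x̃‖² dt)^{1/2} ≤ ε (b/a) √(e^{2aT} - 2e^{aT} + T + 1)`. -/
theorem metriplectic_generalization_error {n : ℕ} (hn : 1 ≤ n)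
    (K : Set (EuclideanSpace ℝ (Fin n))) (T ε : ℝ) (hT : 0 < T) (hε : 0 < ε)
    (E S E' S' : EuclideanSpace ℝ (Fin n) → ℝ)
    (hE : Differentiable ℝ E) (hS : Differentiable ℝ S)
    (hE' : Differentiable ℝ E') (hS' : Differentiable ℝ S')
    (L M L' M' : EuclideanSpace ℝ (Fin n) → Matrix (Fin n) (Fin n) ℝ)
    (LgE LgS LL LM : ℝ)
    (hLipgE : ∀ z ∈ K, ∀ w ∈ K, ‖gradient E z - gradient E w‖ ≤ LgE * ‖z - w‖)
    (hLipgS : ∀ z ∈ K, ∀ w ∈ K, ‖gradient S z - gradient S w‖ ≤ LgS * ‖z - w‖)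
    (hLipL' : ∀ z ∈ K, ∀ w ∈ K, opNorm (L' z - L' w) ≤ LL * ‖z - w‖)
    (hLipM' : ∀ z ∈ K, ∀ w ∈ K, opNorm (M' z - M' w) ≤ LM * ‖z - w‖)
    (hBddL : BddAbove ((fun z => opNorm (L z)) '' K))
    (hBddM : BddAbove ((fun z => opNorm (M z)) '' K))
    (hBddL' : BddAbove ((fun z => opNorm (L' z)) '' K))
    (hBddM' : BddAbove ((fun z => opNorm (M' z)) '' K))
    (hBddgE : BddAbove ((fun z => ‖gradient E z‖) '' K))
    (hBddgS : BddAbove ((fun z => ‖gradient S z‖) '' K))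
    (hεL : ∀ z ∈ K, opNorm (L z - L' z) ≤ ε)
    (hεM : ∀ z ∈ K, opNorm (M z - M' z) ≤ ε)
    (hεgE : ∀ z ∈ K, ‖gradient E z - gradient E' z‖ ≤ ε)
    (hεgS : ∀ z ∈ K, ‖gradient S z - gradient S' z‖ ≤ ε)
    (a b : ℝ)
    (ha_def : a =
      LgE * sSup ((fun z => opNorm (L z)) '' K) +
        LL * sSup ((fun z => ‖gradient E z‖) '' K) +
        LgS * sSup ((fun z => opNorm (M z)) '' K) +
        LM * sSup ((fun z => ‖gradient S z‖) '' K))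
    (hb_def : b =
      sSup ((fun z => opNorm (L' z)) '' K) +
        sSup ((fun z => ‖gradient E z‖) '' K) +
        sSup ((fun z => opNorm (M' z)) '' K) +
        sSup ((fun z => ‖gradient S z‖) '' K))
    (ha : 1 / 2 ≤ a)
    (x z : ℝ → EuclideanSpace ℝ (Fin n))
    (hxK : ∀ t ∈ Icc (0 : ℝ) T, x t ∈ K)
    (hzK : ∀ t ∈ Icc (0 : ℝ) T, z t ∈ K)
    (h0 : x 0 = z 0)
    (hdx : ∀ t ∈ Icc (0 : ℝ) T, HasDerivAt x
      (mulVecE (L (x t)) (gradient E (x t)) + mulVecE (M (x t)) (gradient S (x t))) t)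
    (hdz : ∀ t ∈ Icc (0 : ℝ) T, HasDerivAt z
      (mulVecE (L' (z t)) (gradient E' (z t)) + mulVecE (M' (z t)) (gradient S' (z t))) t) :
    Real.sqrt (∫ t in (0 : ℝ)..T, ‖x t - z t‖ ^ 2) ≤
      ε * (b / a) * Real.sqrt (Real.exp (2 * a * T) - 2 * Real.exp (a * T) + T + 1) := by
  have hsSup {f : EuclideanSpace ℝ (Fin n) → ℝ} (hf : ∀ w, 0 ≤ f w) : 0 ≤ sSup (f '' K) :=
    Real.sSup_nonneg (forall_mem_image.2 fun w _ => hf w)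
  have hb : 0 ≤ b := by
    rw [hb_def]
    have hL' := hsSup fun w => opNorm_nonneg (L' w)
    have hM' := hsSup fun w => opNorm_nonneg (M' w)
    have hgE := hsSup fun w => norm_nonneg (gradient E w)
    have hgS := hsSup fun w => norm_nonneg (gradient S w)
    linarith
  rw [← mul_div_assoc]
  refine sqrt_integral_norm_sq_le_of_norm_deriv_le (y := fun t => x t - z t) ha
    (mul_nonneg hε.le hb) hT.le (sub_eq_zero.2 h0)
    (fun t ht => (hdx t ht).sub (hdz t ht)) fun t ht => ?_
  have hEnergy := norm_mulVecE_sub_mulVecE_le hLipgE hLipL' hBddL hBddL' hBddgE hεL hεgE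
    (hxK t ht) (hzK t ht)
  have hEntropy := norm_mulVecE_sub_mulVecE_le hLipgS hLipM' hBddM hBddM' hBddgS hεM hεgS
    (hxK t ht) (hzK t ht)
  rw [add_sub_add_comm, ha_def, hb_def]
  refine (norm_add_le _ _).trans ?_
  linarith
end
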